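/- Let A_1,…,A_n and E_1,…,E_n be points of ℤ² such that for all i < j the point A_i is weakly south-east of A_j and E_i is weakly south-east of E_j. Then the number of families (P_1,…,P_n) of pairwise vertex-disjoint lattice paths with unit north and east steps, P_i running from A_i to E_i, equals det(P(A_i → E_j))_{1≤i,j≤n}, where P(A → E) is the number of lattice paths from A to E. -/

import Mathlib

/-- The number of lattice paths (unit east and north steps) from `A` to `E`. -/
def pathCount (A E : ℤ × ℤ) : ℕ :=
  if A.1 ≤ E.1 ∧ A.2 ≤ E.2 then
    Nat.choose ((E.1 - A.1) + (E.2 - A.2)).toNat (E.1 - A.1).toNat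
  else 0

/-- `L` is a lattice path from `A` to `E`, given as its list of vertices:
consecutive vertices differ by a unit east step or a unit north step. -/
def IsLatticePath (A E : ℤ × ℤ) (L : List (ℤ × ℤ)) : Prop :=
  L.head? = some A ∧ L.getLast? = some E ∧
    List.Chain' (fun p q => q = (p.1 + 1, p.2) ∨ q = (p.1, p.2 + 1)) L

theorem isLP_iff (A E : ℤ × ℤ) (L : List (ℤ × ℤ)) :
    IsLatticePath A E L ↔ (L = [A] ∧ A = E) ∨
      ∃ L', L = A :: L' ∧ (IsLatticePath (A.1 + 1, A.2) E L' ∨ IsLatticePath (A.1, A.2 + 1) E L') := by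
  unfold IsLatticePath List.Chain'
  match L with
  | [] => simp
  | [a] =>
    simp
    rintro rfl
    rfl
  | a :: b :: L =>
    simp only [List.head?_cons, Option.some.injEq, List.getLast?_cons_cons, List.isChain_cons_cons]
    constructor
    · rintro ⟨rfl, h2, h3 | h3, h4⟩
      · right; exact ⟨_, rfl, Or.inl ⟨by simp [h3], h2, h4⟩⟩
      · right; exact ⟨_, rfl, Or.inr ⟨by simp [h3], h2, h4⟩⟩
    · rintro (⟨h, _⟩ | ⟨L', h, h'⟩)
      · simp at h
      · simp only [List.cons.injEq] at h
        obtain ⟨rfl, rfl⟩ := h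
        rcases h' with ⟨h1, h2, h3⟩ | ⟨h1, h2, h3⟩
        · simp at h1; exact ⟨rfl, h2, Or.inl h1, h3⟩
        · simp at h1; exact ⟨rfl, h2, Or.inr h1, h3⟩

theorem isLP_mem {A E : ℤ × ℤ} {L : List (ℤ × ℤ)} (h : IsLatticePath A E L) :
    ∀ v ∈ L, A.1 ≤ v.1 ∧ A.2 ≤ v.2 ∧ v.1 ≤ E.1 ∧ v.2 ≤ E.2 := by
  induction L generalizing A with
  | nil => simp
  | cons a L ih =>
    rw [isLP_iff] at h
    rcases h with ⟨h, rfl⟩ | ⟨L', h, h'⟩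
    · rw [h]; simp
    · simp only [List.cons.injEq] at h
      obtain ⟨rfl, rfl⟩ := h
      have key : a.1 ≤ E.1 ∧ a.2 ≤ E.2 ∧ ∀ v ∈ L, a.1 ≤ v.1 ∧ a.2 ≤ v.2 ∧ v.1 ≤ E.1 ∧ v.2 ≤ E.2 := by
        rcases h' with h' | h'
        · have h1 := ih h'
          have h2 := h1 _ (List.mem_of_mem_head? h'.1)
          simp only at h1 h2
          refine ⟨by omega, by omega, fun v hv => ?_⟩
          have := h1 v hv; omega
        · have h1 := ih h'
          have h2 := h1 _ (List.mem_of_mem_head? h'.1)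
          simp only at h1 h2
          refine ⟨by omega, by omega, fun v hv => ?_⟩
          have := h1 v hv; omega
      intro v hv
      rcases List.mem_cons.1 hv with rfl | hv
      · omega
      · exact key.2.2 v hv

theorem isLP_start {A E : ℤ × ℤ} {L : List (ℤ × ℤ)} (h : IsLatticePath A E L) : A ∈ L :=
  List.mem_of_mem_head? h.1

theorem isLP_end {A E : ℤ × ℤ} {L : List (ℤ × ℤ)} (h : IsLatticePath A E L) : E ∈ L :=
  List.mem_of_mem_getLast? h.2.1

theorem isLP_le {A E : ℤ × ℤ} {L : List (ℤ × ℤ)} (h : IsLatticePath A E L) :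
    A.1 ≤ E.1 ∧ A.2 ≤ E.2 := by
  have := isLP_mem h _ (isLP_start h); omega

theorem isLP_self (A : ℤ × ℤ) (L : List (ℤ × ℤ)) : IsLatticePath A A L ↔ L = [A] := by
  rw [isLP_iff]
  constructor
  · rintro (h | ⟨L', h, h' | h'⟩)
    · exact h.1
    · have := isLP_le h'; simp only at this; omega
    · have := isLP_le h'; simp only at this; omega
  · intro h; simp [h]

theorem isLP_finite (m : ℕ) (A E : ℤ × ℤ) (h : E.1 + E.2 - A.1 - A.2 < m) :
    {L | IsLatticePath A E L}.Finite := by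
  induction m generalizing A with
  | zero =>
    convert Set.finite_empty
    ext L
    simp only [Set.mem_ofPred_eq, Set.mem_empty_iff_false, iff_false]
    intro hL
    have := isLP_le hL
    push_cast at h
    omega
  | succ m ih =>
    push_cast at h
    have h1 := ih (A.1 + 1, A.2) (by simp only; omega)
    have h2 := ih (A.1, A.2 + 1) (by simp only; omega)
    refine ((Set.finite_singleton [A]).union
      ((h1.image (List.cons A)).union (h2.image (List.cons A)))).subset ?_
    intro L hL
    rcases (isLP_iff _ _ _).1 hL with h | ⟨L', rfl, h | h⟩
    · left; exact h.1
    · right; left; exact ⟨_, h, rfl⟩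
    · right; right; exact ⟨_, h, rfl⟩

theorem pathCount_zero {A E : ℤ × ℤ} (h : ¬ (A.1 ≤ E.1 ∧ A.2 ≤ E.2)) : pathCount A E = 0 := by
  simp [pathCount, h]

theorem pathCount_self (A : ℤ × ℤ) : pathCount A A = 1 := by
  simp [pathCount]

theorem pathCount_rec {A E : ℤ × ℤ} (h : A ≠ E) :
    pathCount A E = pathCount (A.1 + 1, A.2) E + pathCount (A.1, A.2 + 1) E := by
  obtain ⟨a, b⟩ := A
  obtain ⟨c, d⟩ := E
  by_cases h1 : a ≤ c ∧ b ≤ d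
  · obtain ⟨x, hx⟩ := Int.le.dest h1.1
    obtain ⟨y, hy⟩ := Int.le.dest h1.2
    subst hx hy
    have e1 : (a + (x:ℤ) - a) = x := by ring
    have e2 : (b + (y:ℤ) - b) = y := by ring
    rcases x with _ | x
    · rcases y with _ | y
      · simp at h
      · simp [pathCount]
        omega
    · rcases y with _ | y
      · simp [pathCount]
        omega
      · have p1 : pathCount (a, b) (a + ((x+1:ℕ):ℤ), b + ((y+1:ℕ):ℤ)) = (x + 1 + y + 1).choose (x+1) := by
          unfold pathCount
          rw [if_pos (by simp only; omega)]
          congr 1 <;> simp only <;> omega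
        have p2 : pathCount (a+1, b) (a + ((x+1:ℕ):ℤ), b + ((y+1:ℕ):ℤ)) = (x + 1 + y).choose x := by
          unfold pathCount
          rw [if_pos (by simp only; omega)]
          congr 1 <;> simp only <;> omega
        have p3 : pathCount (a, b+1) (a + ((x+1:ℕ):ℤ), b + ((y+1:ℕ):ℤ)) = (x + 1 + y).choose (x+1) := by
          unfold pathCount
          rw [if_pos (by simp only; omega)]
          congr 1 <;> simp only <;> omega
        rw [p1, p2, p3, Nat.choose_succ_succ]
  · rw [pathCount_zero (by simpa using h1), pathCount_zero (by simp only; omega),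
      pathCount_zero (by simp only; omega)]

/-- The set of non-intersecting families. -/
def Fam (n : ℕ) (A E : Fin n → ℤ × ℤ) : Set (Fin n → List (ℤ × ℤ)) :=
  {P | (∀ i, IsLatticePath (A i) (E i) (P i)) ∧ ∀ i j, i ≠ j → ∀ v ∈ P i, v ∉ P j}

def Mat (n : ℕ) (A E : Fin n → ℤ × ℤ) : Matrix (Fin n) (Fin n) ℤ :=
  Matrix.of fun i j : Fin n => (pathCount (A i) (E j) : ℤ)

def SE (n : ℕ) (A : Fin n → ℤ × ℤ) : Prop :=
  ∀ i j : Fin n, i < j → (A j).1 ≤ (A i).1 ∧ (A i).2 ≤ (A j).2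

theorem fam_finite (n : ℕ) (A E : Fin n → ℤ × ℤ) : (Fam n A E).Finite := by
  have : (Set.pi Set.univ fun i => {L | IsLatticePath (A i) (E i) L}).Finite :=
    Set.Finite.pi' (fun i => isLP_finite ((E i).1 + (E i).2 - (A i).1 - (A i).2 + 1).toNat _ _ (by omega)) |>.subset
      (fun P hP i => hP i trivial)
  exact this.subset (fun P hP i _ => hP.1 i)

theorem fam_empty {n : ℕ} {A E : Fin n → ℤ × ℤ} (i : Fin n)
    (h : ¬ ((A i).1 ≤ (E i).1 ∧ (A i).2 ≤ (E i).2)) : Fam n A E = ∅ := by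
  ext P
  simp only [Set.mem_empty_iff_false, iff_false]
  intro hP
  exact h (isLP_le (hP.1 i))

theorem fam_move {n : ℕ} {A E : Fin n → ℤ × ℤ} (i : Fin n)
    (hmin : ∀ k, (A i).1 + (A i).2 ≤ (A k).1 + (A k).2)
    (hne : ∀ k, k ≠ i → A k ≠ A i) (hE : ∀ k, A i ≠ E k) :
    (Fam n A E).ncard = (Fam n (Function.update A i ((A i).1 + 1, (A i).2)) E).ncard +
      (Fam n (Function.update A i ((A i).1, (A i).2 + 1)) E).ncard := by
  set B := Function.update A i ((A i).1 + 1, (A i).2) with hB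
  set C := Function.update A i ((A i).1, (A i).2 + 1) with hC
  have hdisj : Disjoint (Fam n B E) (Fam n C E) := by
    rw [Set.disjoint_left]
    intro P h1 h2
    have h1 := (h1.1 i).1
    have h2 := (h2.1 i).1
    rw [h1] at h2
    simp [hB, hC] at h2
  rw [← Set.ncard_union_eq hdisj (fam_finite _ _ _) (fam_finite _ _ _)]
  symm
  -- a path in any family other than the i-th avoids A i
  have avoid : ∀ k, k ≠ i → ∀ L, IsLatticePath (A k) (E k) L → A i ∉ L := by
    intro k hk L hL hmem
    have h1 := isLP_mem hL _ hmem
    have h2 := hmin k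
    apply hne k hk
    ext <;> omega
  refine Set.ncard_congr (fun P _ => Function.update P i (A i :: P i)) ?_ ?_ ?_
  · intro P hP
    have hk : ∀ k, k ≠ i → IsLatticePath (A k) (E k) (P k) := by
      intro k hk
      rcases hP with hP | hP
      · have := hP.1 k; rwa [hB, Function.update_of_ne hk] at this
      · have := hP.1 k; rwa [hC, Function.update_of_ne hk] at this
    have hd : ∀ i j, i ≠ j → ∀ v ∈ P i, v ∉ P j := by
      rcases hP with hP | hP <;> exact hP.2
    refine ⟨fun k => ?_, fun k l hkl v hv => ?_⟩
    · by_cases h : k = i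
      · subst h
        rw [Function.update_self, isLP_iff]
        right
        refine ⟨_, rfl, ?_⟩
        rcases hP with hP | hP
        · left; have := hP.1 k; rwa [hB, Function.update_self] at this
        · right; have := hP.1 k; rwa [hC, Function.update_self] at this
      · rw [Function.update_of_ne h]; exact hk k h
    · by_cases h : k = i
      · subst h
        rw [Function.update_of_ne hkl.symm]
        rw [Function.update_self] at hv
        rcases List.mem_cons.1 hv with rfl | hv
        · exact avoid l hkl.symm _ (hk l hkl.symm)
        · exact hd _ _ hkl _ hv
      · rw [Function.update_of_ne h] at hv
        by_cases h' : l = i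
        · subst h'
          rw [Function.update_self, List.mem_cons]
          rintro (rfl | h2)
          · exact avoid k h _ (hk k h) hv
          · exact hd _ _ hkl _ hv h2
        · rw [Function.update_of_ne h']; exact hd _ _ hkl _ hv
  · intro P Q _ _ h
    funext k
    have := congrFun h k
    by_cases hk : k = i
    · subst hk; simpa using this
    · simpa [Function.update_of_ne hk] using this
  · intro P hP
    have hi := hP.1 i
    rw [isLP_iff] at hi
    rcases hi with hi | ⟨L, hL, hi⟩
    · exact absurd hi.2 (hE i)
    · refine ⟨Function.update P i L, ?_, by simp [← hL]⟩
      have hd : ∀ k l, k ≠ l → ∀ v ∈ Function.update P i L k, v ∉ Function.update P i L l := by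
        have sub : ∀ k, ∀ v ∈ Function.update P i L k, v ∈ P k := by
          intro k v hv
          by_cases h : k = i
          · subst h; rw [Function.update_self] at hv; rw [hL]; exact List.mem_cons_of_mem _ hv
          · rwa [Function.update_of_ne h] at hv
        intro k l hkl v hv hv'
        exact hP.2 k l hkl v (sub _ _ hv) (sub _ _ hv')
      rcases hi with hi | hi
      · left
        refine ⟨fun k => ?_, hd⟩
        by_cases h : k = i
        · subst h; simpa [hB] using hi
        · simpa [hB, Function.update_of_ne h] using hP.1 k
      · right
        refine ⟨fun k => ?_, hd⟩
        by_cases h : k = i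
        · subst h; simpa [hC] using hi
        · simpa [hC, Function.update_of_ne h] using hP.1 k

theorem det_move {n : ℕ} {A E : Fin n → ℤ × ℤ} (i : Fin n) (hE : ∀ k, A i ≠ E k) :
    (Mat n A E).det = (Mat n (Function.update A i ((A i).1 + 1, (A i).2)) E).det +
      (Mat n (Function.update A i ((A i).1, (A i).2 + 1)) E).det := by
  have key : ∀ p, Mat n (Function.update A i p) E =
      (Mat n A E).updateRow i (fun j => (pathCount p (E j) : ℤ)) := by
    intro p
    ext k l
    by_cases h : k = i
    · subst h; simp [Mat]
    · simp [Mat, Matrix.updateRow_ne h, Function.update_of_ne h]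
  rw [key, key, ← Matrix.det_updateRow_add]
  congr 1
  ext k l
  by_cases h : k = i
  · subst h; simp [Mat, pathCount_rec (hE l)]
  · simp [Matrix.updateRow_ne h]

theorem fam_delete {n : ℕ} {A E : Fin (n+1) → ℤ × ℤ} (i : Fin (n+1))
    (hmin : ∀ k, (A i).1 + (A i).2 ≤ (A k).1 + (A k).2)
    (hne : ∀ k, k ≠ i → A k ≠ A i) (hE : A i = E i) :
    (Fam (n+1) A E).ncard = (Fam n (A ∘ i.succAbove) (E ∘ i.succAbove)).ncard := by
  have avoid : ∀ k, k ≠ i → ∀ L, IsLatticePath (A k) (E k) L → A i ∉ L := by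
    intro k hk L hL hmem
    have h1 := isLP_mem hL _ hmem
    have h2 := hmin k
    apply hne k hk
    ext <;> omega
  refine Set.ncard_congr (fun P _ => P ∘ i.succAbove) ?_ ?_ ?_
  · intro P hP
    exact ⟨fun k => hP.1 _, fun k l hkl => hP.2 _ _ (by simpa using hkl)⟩
  · intro P Q hP hQ h
    funext k
    rcases Fin.eq_self_or_eq_succAbove i k with rfl | ⟨l, rfl⟩
    · have h1 := hP.1 k
      have h2 := hQ.1 k
      rw [← hE, isLP_self] at h1 h2
      rw [h1, h2]
    · exact congrFun h l
  · intro P hP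
    refine ⟨i.insertNth (α := fun _ => List (ℤ × ℤ)) [A i] P, ⟨?_, ?_⟩, ?_⟩
    · intro k
      rcases Fin.eq_self_or_eq_succAbove i k with rfl | ⟨l, rfl⟩
      · rw [Fin.insertNth_apply_same, ← hE, isLP_self]
      · rw [Fin.insertNth_apply_succAbove]; exact hP.1 l
    · intro k l hkl v
      rcases Fin.eq_self_or_eq_succAbove i k with rfl | ⟨k, rfl⟩
      · rcases Fin.eq_self_or_eq_succAbove k l with rfl | ⟨l, rfl⟩
        · exact absurd rfl hkl
        · rw [Fin.insertNth_apply_same, Fin.insertNth_apply_succAbove, List.mem_singleton]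
          rintro rfl
          exact avoid _ hkl.symm _ (hP.1 l)
      · rcases Fin.eq_self_or_eq_succAbove i l with rfl | ⟨l, rfl⟩
        · rw [Fin.insertNth_apply_same, Fin.insertNth_apply_succAbove, List.mem_singleton]
          rintro h rfl
          exact avoid _ hkl _ (hP.1 k) h
        · rw [Fin.insertNth_apply_succAbove, Fin.insertNth_apply_succAbove]
          exact hP.2 _ _ (by simpa using hkl) v
    · funext k
      simp

theorem det_delete {n : ℕ} {A E : Fin (n+1) → ℤ × ℤ} (i j : Fin (n+1))
    (hmin : ∀ k, (A i).1 + (A i).2 ≤ (A k).1 + (A k).2)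
    (hne : ∀ k, k ≠ i → A k ≠ A i) (hE : A i = E j) :
    (Mat (n+1) A E).det =
      (-1) ^ ((i : ℕ) + j) * (Mat n (A ∘ i.succAbove) (E ∘ j.succAbove)).det := by
  rw [Matrix.det_succ_column _ j, Finset.sum_eq_single i]
  · have : Mat (n+1) A E i j = 1 := by simp [Mat, ← hE, pathCount_self]
    rw [this, mul_one]
    rfl
  · intro k _ hk
    have : Mat (n+1) A E k j = 0 := by
      simp only [Mat, Matrix.of_apply, ← hE, Nat.cast_eq_zero]
      apply pathCount_zero
      intro h
      have := hmin k
      apply hne k hk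
      ext <;> omega
    simp [this]
  · simp

theorem lgv (n : ℕ) : ∀ (A E : Fin n → ℤ × ℤ), SE n A → SE n E →
    ((Fam n A E).ncard : ℤ) = (Mat n A E).det := by
  induction n with
  | zero =>
    intro A E _ _
    have : Fam 0 A E = Set.univ := by ext P; simp [Fam]
    rw [this]; simp
  | succ n ih =>
    intro A E hA hE
    obtain ⟨M, hM⟩ : ∃ M : ℤ, ∀ k, (E k).1 + (E k).2 < M := by
      obtain ⟨M, hM⟩ := (Set.finite_range fun k => (E k).1 + (E k).2).bddAbove
      exact ⟨M + 1, fun k => by have := hM ⟨k, rfl⟩; simp only at this; omega⟩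
    obtain ⟨m, hm⟩ : ∃ m : ℕ, ∑ k, (M - ((A k).1 + (A k).2)).toNat ≤ m := ⟨_, le_rfl⟩
    induction m using Nat.strong_induction_on generalizing A with
    | _ m ihm =>
    obtain ⟨i, hmin⟩ := Finite.exists_min (fun k => (A k).1 + (A k).2)
    by_cases hne : ∀ k, k ≠ i → A k ≠ A i
    swap
    · push Not at hne
      obtain ⟨k, hk, hki⟩ := hne
      have h1 : Fam (n+1) A E = ∅ := by
        ext P
        simp only [Set.mem_empty_iff_false, iff_false]
        intro hP
        have := hP.2 k i hk _ (isLP_start (hP.1 k))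
        rw [hki] at this
        exact this (isLP_start (hP.1 i))
      rw [h1, Matrix.det_zero_of_row_eq hk]
      · simp
      · ext l; simp [Mat, hki]
    have hlt : ∀ k, k < i → (A i).1 + 1 ≤ (A k).1 ∧ (A k).2 ≤ (A i).2 := by
      intro k hk
      have h1 := hA k i hk
      have h2 := hmin k
      have h3 := hne k hk.ne
      refine ⟨?_, h1.2⟩
      by_contra h4
      apply h3
      ext <;> omega
    have hgt : ∀ k, i < k → (A k).1 ≤ (A i).1 ∧ (A i).2 + 1 ≤ (A k).2 := by
      intro k hk
      have h1 := hA i k hk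
      have h2 := hmin k
      have h3 := hne k hk.ne'
      refine ⟨h1.1, ?_⟩
      by_contra h4
      apply h3
      ext <;> omega
    by_cases hex : ∃ j, A i = E j
    · obtain ⟨j, hj⟩ := hex
      rw [det_delete i j hmin hne hj, ← ih (A ∘ i.succAbove) (E ∘ j.succAbove)
        (fun k l hkl => hA _ _ (by simpa using hkl)) (fun k l hkl => hE _ _ (by simpa using hkl))]
      by_cases hij : j = i
      · subst hij
        rw [fam_delete j hmin hne hj, ← two_mul, pow_mul]
        simp
      · have h1 : Fam (n+1) A E = ∅ := by
          ext P
          simp only [Set.mem_empty_iff_false, iff_false]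
          intro hP
          have := hP.2 j i hij _ (isLP_end (hP.1 j))
          rw [← hj] at this
          exact this (isLP_start (hP.1 i))
        have h2 : Fam n (A ∘ i.succAbove) (E ∘ j.succAbove) = ∅ := by
          rcases lt_or_gt_of_ne hij with h | h
          · have hr : (j : ℕ) < n := by have := i.2; have : (j:ℕ) < i := h; omega
            apply fam_empty ⟨j, hr⟩
            have e1 : i.succAbove ⟨j, hr⟩ = j := by
              rw [Fin.succAbove_of_castSucc_lt _ _ (by exact h)]; rfl
            have e2 : j < j.succAbove ⟨j, hr⟩ := by
              rw [Fin.succAbove_of_le_castSucc _ _ (by exact le_rfl)]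
              simp [Fin.lt_def]
            simp only [Function.comp, e1]
            have h3 := hE _ _ e2
            have h4 := hlt j h
            rw [hj] at h4
            omega
          · have hr : (i : ℕ) < n := by have := j.2; have : (i:ℕ) < j := h; omega
            apply fam_empty ⟨i, hr⟩
            have e1 : j.succAbove ⟨i, hr⟩ = i := by
              rw [Fin.succAbove_of_castSucc_lt _ _ (by exact h)]; rfl
            have e2 : i < i.succAbove ⟨i, hr⟩ := by
              rw [Fin.succAbove_of_le_castSucc _ _ (by exact le_rfl)]
              simp [Fin.lt_def]
            simp only [Function.comp, e1]
            have h3 := hE _ _ h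
            have h4 := hgt _ e2
            rw [hj] at h4
            omega
        rw [h1, h2]; simp
    · push Not at hex
      by_cases hiM : M ≤ (A i).1 + (A i).2
      · have hz : ∀ j, ¬ ((A i).1 ≤ (E j).1 ∧ (A i).2 ≤ (E j).2) := by
          intro j; have := hM j; omega
        rw [fam_empty i (hz i), Matrix.det_eq_zero_of_row_eq_zero i]
        · simp
        · intro j; simp [Mat, pathCount_zero (hz j)]
      · have hsum : ∀ p : ℤ × ℤ, p.1 + p.2 = (A i).1 + (A i).2 + 1 →
            ∑ k, (M - ((Function.update A i p k).1 + (Function.update A i p k).2)).toNat < m := by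
          intro p hp
          refine lt_of_lt_of_le (Finset.sum_lt_sum ?_ ⟨i, Finset.mem_univ _, ?_⟩) hm
          · intro k _
            by_cases h : k = i
            · subst h; rw [Function.update_self]; omega
            · rw [Function.update_of_ne h]
          · rw [Function.update_self]; omega
        have hSE : ∀ p : ℤ × ℤ, (A i).1 ≤ p.1 → (A i).2 ≤ p.2 → p.1 ≤ (A i).1 + 1 →
            p.2 ≤ (A i).2 + 1 → SE (n+1) (Function.update A i p) := by
          intro p h1 h2 h3 h4 k l hkl
          by_cases hk : k = i
          · subst hk
            rw [Function.update_self, Function.update_of_ne hkl.ne']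
            have := hgt l hkl; omega
          · by_cases hl : l = i
            · subst hl
              rw [Function.update_self, Function.update_of_ne hk]
              have := hlt k hkl; omega
            · rw [Function.update_of_ne hk, Function.update_of_ne hl]
              exact hA k l hkl
        rw [fam_move i hmin hne hex, det_move i hex]
        push_cast
        rw [ihm _ (hsum ((A i).1 + 1, (A i).2) (by simp only; omega)) _
            (hSE _ (by simp) (by simp) (by simp) (by simp)) le_rfl,
          ihm _ (hsum ((A i).1, (A i).2 + 1) (by simp only; omega)) _
            (hSE _ (by simp) (by simp) (by simp) (by simp)) le_rfl]

theorem stmt8 (n : ℕ) (A E : Fin n → ℤ × ℤ)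
    (hA : ∀ i j : Fin n, i < j → (A j).1 ≤ (A i).1 ∧ (A i).2 ≤ (A j).2)
    (hE : ∀ i j : Fin n, i < j → (E j).1 ≤ (E i).1 ∧ (E i).2 ≤ (E j).2) :
    (Nat.card {P : Fin n → List (ℤ × ℤ) //
        (∀ i, IsLatticePath (A i) (E i) (P i)) ∧
        ∀ i j, i ≠ j → ∀ v ∈ P i, v ∉ P j} : ℤ)
      = Matrix.det (Matrix.of fun i j : Fin n => (pathCount (A i) (E j) : ℤ)) := by
  exact lgv n A E hA hE
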